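/- Let K = [−1,1]^n and let μ be the product Chebyshev measure on K. Suppose K_r : K × K → ℝ is of the form K_r(x,y) = Σ_{α ∈ ℕ^n_r} g_α T_α(x) T_α(y) with real coefficients g_α, that K_r(x,y) ≥ 0 for all (x,y) ∈ K × K, and that ∫_K K_r(x,y) dμ(y) = 1 for all x ∈ K. Define σ_r = (∫_{K×K} ‖x−y‖² K_r(x,y) dμ(x) dμ(y))^{1/2} and, for continuous f : K → ℝ, define 𝒦^{(r)}(f)(x) = ∫_K f(y) K_r(x,y) dμ(y). Then for every continuous f : K → ℝ, sup_{x ∈ K} |𝒦^{(r)}(f)(x) − f(x)| ≤ 2(1 + π/√2) ω_f(σ_r). -/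

import Mathlib

open MeasureTheory Real Finset

noncomputable section

/-- The Chebyshev (arcsine) measure on ℝ, supported on [-1,1]. -/
def chebMeasure1 : Measure ℝ :=
  (volume.restrict (Set.Icc (-1 : ℝ) 1)).withDensity
    (fun x => ENNReal.ofReal ((π * Real.sqrt (1 - x ^ 2))⁻¹))

/-- The product Chebyshev measure on [-1,1]^n. -/
def chebMeasure (n : ℕ) : Measure (Fin n → ℝ) := Measure.pi fun _ => chebMeasure1

/-- The hypercube [-1,1]^n. -/
def box (n : ℕ) : Set (Fin n → ℝ) := Set.univ.pi fun _ => Set.Icc (-1 : ℝ) 1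

/-- Euclidean norm on ℝ^n. -/
def eNorm {n : ℕ} (x : Fin n → ℝ) : ℝ := Real.sqrt (∑ i, x i ^ 2)

/-- Chebyshev polynomial of the first kind, evaluated. -/
def T1 (k : ℕ) (x : ℝ) : ℝ := (Polynomial.Chebyshev.T ℝ (k : ℤ)).eval x

/-- Multivariate Chebyshev polynomial. -/
def Tm {n : ℕ} (α : Fin n → ℕ) (x : Fin n → ℝ) : ℝ := ∏ i, T1 (α i) (x i)

/-- The set ℕ^n_r of multi-indices of total degree at most r, as a finset. -/
def Nnr (n r : ℕ) : Finset (Fin n → ℕ) :=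
  (Fintype.piFinset fun _ => Finset.range (r + 1)).filter fun α => ∑ i, α i ≤ r

/-- Hamming weight: number of nonzero entries. -/
def ham {n : ℕ} (α : Fin n → ℕ) : ℕ := (Finset.univ.filter fun i => α i ≠ 0).card

/-- Modulus of continuity of `f` on the set `S`, w.r.t. the Euclidean norm. -/
def modCont {n : ℕ} (f : (Fin n → ℝ) → ℝ) (S : Set (Fin n → ℝ)) (δ : ℝ) : ℝ :=
  sSup {t : ℝ | ∃ x ∈ S, ∃ y ∈ S, eNorm (x - y) ≤ δ ∧ t = |f x - f y|}

open Polynomial.Chebyshev in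
lemma cheb1_eq : chebMeasure1 = ENNReal.ofReal π⁻¹ • measureT := by
  unfold chebMeasure1 measureT
  rw [restrict_withDensity measurableSet_Ioc, ← Measure.restrict_congr_set (Ioc_ae_eq_Icc (μ := volume) (a := (-1:ℝ)) (b := 1)),
    ← withDensity_smul _ (by fun_prop)]
  congr 1
  funext x
  simp only [Pi.smul_apply, smul_eq_mul]
  rw [mul_inv, ENNReal.ofReal_mul (by positivity)]
  congr 1
  rw [← Real.sqrt_inv]
  rw [ENNReal.ofReal]
  congr 1
  ext
  simp

open Polynomial.Chebyshev in
lemma cheb1_integral (f : ℝ → ℝ) : ∫ x, f x ∂chebMeasure1 = π⁻¹ * ∫ x, f x ∂measureT := by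
  rw [cheb1_eq, integral_smul_measure, ENNReal.toReal_ofReal (by positivity), smul_eq_mul]

open Polynomial.Chebyshev in
instance cheb1_prob : IsProbabilityMeasure chebMeasure1 := by
  have h1 : Integrable (fun _ : ℝ => (1 : ℝ)) measureT := integrable_measureT (by fun_prop)
  have h2 : Integrable (fun _ : ℝ => (1 : ℝ)) chebMeasure1 := by
    rw [cheb1_eq]; exact h1.smul_measure (by simp)
  have h3 : IsFiniteMeasure chebMeasure1 := by
    rwa [integrable_const_iff_isFiniteMeasure one_ne_zero] at h2
  have h4 : ∫ x, (1 : ℝ) ∂chebMeasure1 = 1 := by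
    rw [cheb1_integral]
    have := integral_eval_T_real_measureT_zero
    simp only [T_zero, Polynomial.eval_one] at this
    rw [this]; field_simp
  constructor
  simp only [integral_const, smul_eq_mul, mul_one, Measure.real] at h4
  rw [← ENNReal.ofReal_toReal (measure_ne_top chebMeasure1 Set.univ), h4]; simp

instance cheb_prob (n : ℕ) : IsProbabilityMeasure (chebMeasure n) := by
  unfold chebMeasure; infer_instance

lemma cheb1_Icc : chebMeasure1 (Set.Icc (-1) 1) = 1 := by
  rw [← mem_ae_iff_prob_eq_one measurableSet_Icc]
  unfold chebMeasure1
  exact withDensity_absolutelyContinuous _ _ (self_mem_ae_restrict measurableSet_Icc)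

lemma box_compact (n : ℕ) : IsCompact (box n) := isCompact_univ_pi fun _ => isCompact_Icc

lemma ae_box (n : ℕ) : ∀ᵐ y ∂(chebMeasure n), y ∈ box n := by
  have : box n ∈ ae (chebMeasure n) := by
    rw [mem_ae_iff_prob_eq_one (box_compact n).measurableSet]
    unfold chebMeasure _root_.box
    rw [Measure.pi_pi]; simp [cheb1_Icc]
  exact this

lemma cheb_integrable {n : ℕ} {f : (Fin n → ℝ) → ℝ} (hf : ContinuousOn f (box n)) :
    Integrable f (chebMeasure n) := by
  have := hf.integrableOn_compact (μ := chebMeasure n) (box_compact n)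
  rwa [IntegrableOn, Measure.restrict_eq_self_of_ae_mem (ae_box n)] at this

lemma T1_orth {k l : ℕ} (h : k ≠ l) : ∫ x, T1 k x * T1 l x ∂chebMeasure1 = 0 := by
  unfold T1
  rw [cheb1_integral, Polynomial.Chebyshev.integral_eval_T_real_mul_eval_T_real_measureT_of_ne h,
    mul_zero]

@[fun_prop]
lemma T1_cont (k : ℕ) : Continuous (T1 k) := by unfold T1; fun_prop

@[fun_prop]
lemma Tm_cont {n : ℕ} (α : Fin n → ℕ) : Continuous (Tm α) := by unfold Tm; fun_prop

lemma Tm_orth {n : ℕ} {α β : Fin n → ℕ} (h : α ≠ β) :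
    ∫ x, Tm α x * Tm β x ∂chebMeasure n = 0 := by
  obtain ⟨i, hi⟩ := Function.ne_iff.mp h
  simp only [Tm, ← Finset.prod_mul_distrib]
  unfold chebMeasure
  rw [integral_fintype_prod_eq_prod (f := fun i t => T1 (α i) t * T1 (β i) t)]
  exact Finset.prod_eq_zero (Finset.mem_univ i) (T1_orth hi)

lemma Tm_zero {n : ℕ} (x : Fin n → ℝ) : Tm 0 x = 1 := by simp [Tm, T1]

lemma Tm_one {n : ℕ} (i : Fin n) (x : Fin n → ℝ) : Tm (Pi.single i 1) x = x i := by
  unfold Tm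
  rw [Finset.prod_eq_single i]
  · simp [T1]
  · intro j _ hj; simp [T1, hj]
  · simp

lemma Tm_two {n : ℕ} (i : Fin n) (x : Fin n → ℝ) :
    Tm (Pi.single i 2) x = 2 * x i ^ 2 - 1 := by
  unfold Tm
  rw [Finset.prod_eq_single i]
  · simp [T1, Polynomial.Chebyshev.T_two]
  · intro j _ hj; simp [T1, hj]
  · simp

lemma int_sq {n : ℕ} (i : Fin n) : ∫ x, x i ^ 2 ∂chebMeasure n = 1 / 2 := by
  have h := Tm_orth (n := n) (α := Pi.single i 2) (β := 0) (by simp)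
  simp only [Tm_zero, Tm_two, mul_one] at h
  rw [integral_sub (cheb_integrable (by fun_prop)) (by simp), integral_const_mul] at h
  simp at h
  linarith

lemma reproduce {n r : ℕ} {g : (Fin n → ℕ) → ℝ} {K : (Fin n → ℝ) → (Fin n → ℝ) → ℝ}
    (hK : ∀ x y, K x y = ∑ α ∈ Nnr n r, g α * Tm α x * Tm α y) (β : Fin n → ℕ) :
    ∃ c : ℝ, ∀ x, ∫ y, Tm β y * K x y ∂chebMeasure n = c * Tm β x := by
  have key : ∀ x, ∫ y, Tm β y * K x y ∂chebMeasure n =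
      ∑ α ∈ Nnr n r, g α * Tm α x * ∫ y, Tm β y * Tm α y ∂chebMeasure n := by
    intro x
    simp only [hK, Finset.mul_sum]
    rw [integral_finsetSum _ (fun α _ => cheb_integrable (by fun_prop))]
    refine Finset.sum_congr rfl fun α _ => ?_
    rw [← integral_const_mul]
    congr 1; funext y; ring
  by_cases hβ : β ∈ Nnr n r
  · refine ⟨g β * ∫ y, Tm β y * Tm β y ∂chebMeasure n, fun x => ?_⟩
    rw [key, Finset.sum_eq_single_of_mem β hβ]
    · ring
    · intro α _ h; rw [Tm_orth h.symm, mul_zero]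
  · refine ⟨0, fun x => ?_⟩
    rw [key, zero_mul]
    refine Finset.sum_eq_zero fun α hα => ?_
    rw [Tm_orth (by rintro rfl; exact hβ hα), mul_zero]

lemma eNorm_sq {n : ℕ} (x : Fin n → ℝ) : eNorm x ^ 2 = ∑ i, x i ^ 2 :=
  Real.sq_sqrt (Finset.sum_nonneg fun _ _ => sq_nonneg _)

lemma eNorm_nonneg {n : ℕ} (x : Fin n → ℝ) : 0 ≤ eNorm x := Real.sqrt_nonneg _

lemma eNorm_smul {n : ℕ} (c : ℝ) (hc : 0 ≤ c) (x : Fin n → ℝ) : eNorm (c • x) = c * eNorm x := by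
  unfold eNorm
  simp only [Pi.smul_apply, smul_eq_mul, mul_pow, ← Finset.mul_sum]
  rw [Real.sqrt_mul (sq_nonneg _), Real.sqrt_sq hc]

lemma modCont_le {n : ℕ} {f : (Fin n → ℝ) → ℝ} (hf : ContinuousOn f (box n)) {δ : ℝ}
    {x y : Fin n → ℝ} (hx : x ∈ box n) (hy : y ∈ box n) (h : eNorm (x - y) ≤ δ) :
    |f x - f y| ≤ modCont f (box n) δ := by
  obtain ⟨C, hC⟩ := (box_compact n).exists_bound_of_continuousOn hf
  refine le_csSup ⟨C + C, ?_⟩ ⟨x, hx, y, hy, h, rfl⟩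
  rintro t ⟨a, ha, b, hb, _, rfl⟩
  have h1 := hC a ha
  have h2 := hC b hb
  rw [Real.norm_eq_abs] at h1 h2
  exact (abs_sub _ _).trans (add_le_add h1 h2)

lemma modCont_nonneg {n : ℕ} (f : (Fin n → ℝ) → ℝ) (S : Set (Fin n → ℝ)) (δ : ℝ) :
    0 ≤ modCont f S δ := by
  refine Real.sSup_nonneg ?_
  rintro t ⟨a, ha, b, hb, _, rfl⟩
  exact abs_nonneg _

lemma chain_bound {n : ℕ} {f : (Fin n → ℝ) → ℝ} (hf : ContinuousOn f (box n)) {δ : ℝ}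
    {x y : Fin n → ℝ} (hx : x ∈ box n) (hy : y ∈ box n) (N : ℕ) (hN : 0 < N)
    (h : eNorm (x - y) ≤ N * δ) :
    |f x - f y| ≤ N * modCont f (box n) δ := by
  have hN' : (0 : ℝ) < N := by exact_mod_cast hN
  let p : ℕ → Fin n → ℝ := fun k => (1 - (k : ℝ) / N) • x + ((k : ℝ) / N) • y
  have hconv : Convex ℝ (box n) := convex_pi fun _ _ => convex_Icc _ _
  have hp : ∀ k ≤ N, p k ∈ box n := by
    intro k hk
    have hk' : (k : ℝ) ≤ N := by exact_mod_cast hk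
    have h1 : (k : ℝ) / N ≤ 1 := by rw [div_le_one hN']; exact hk'
    exact hconv hx hy (by linarith) (by positivity) (by ring)
  have hstep : ∀ k < N, |f (p k) - f (p (k + 1))| ≤ modCont f (box n) δ := by
    intro k hk
    refine modCont_le hf (hp k hk.le) (hp (k + 1) hk) ?_
    have : p k - p (k + 1) = (1 / (N : ℝ)) • (x - y) := by
      funext i
      simp only [p, Pi.sub_apply, Pi.add_apply, Pi.smul_apply, smul_eq_mul]
      push_cast
      field_simp
      ring
    rw [this, eNorm_smul _ (by positivity), one_div, inv_mul_le_iff₀ hN']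
    exact h
  have hind : ∀ k ≤ N, |f (p 0) - f (p k)| ≤ k * modCont f (box n) δ := by
    intro k
    induction k with
    | zero => intro _; simp
    | succ k ih =>
      intro hk
      have h1 := ih (by omega)
      have h2 := hstep k hk
      have h3 := abs_sub_le (f (p 0)) (f (p k)) (f (p (k + 1)))
      push_cast
      linarith
  have := hind N le_rfl
  simpa [p, hN'.ne'] using this

lemma quad_bound {n : ℕ} {f : (Fin n → ℝ) → ℝ} (hf : ContinuousOn f (box n)) {δ : ℝ} (hδ : 0 < δ)
    {x y : Fin n → ℝ} (hx : x ∈ box n) (hy : y ∈ box n) :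
    |f x - f y| ≤ (1 + eNorm (x - y) ^ 2 / δ ^ 2) * modCont f (box n) δ := by
  set s := eNorm (x - y) / δ with hs
  have hs0 : 0 ≤ s := div_nonneg (eNorm_nonneg _) hδ.le
  have hsq : eNorm (x - y) ^ 2 / δ ^ 2 = s ^ 2 := by rw [hs, div_pow]
  have hx' : eNorm (x - y) = s * δ := by rw [hs]; field_simp
  have hm := modCont_nonneg f (box n) δ
  rw [hsq]
  by_cases h1 : s ≤ 1
  · have := modCont_le hf hx hy (δ := δ) (by rw [hx']; nlinarith)
    nlinarith [mul_nonneg (sq_nonneg s) hm]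
  · push Not at h1
    have := chain_bound hf hx hy (δ := δ) ⌈s⌉₊ (Nat.ceil_pos.mpr (by linarith))
      (by rw [hx']; exact mul_le_mul_of_nonneg_right (Nat.le_ceil s) hδ.le)
    refine this.trans (mul_le_mul_of_nonneg_right ?_ hm)
    have := (Nat.ceil_lt_add_one hs0).le
    nlinarith

/-- Jackson-type error bound for a nonnegative, normalized polynomial
kernel on the hypercube, in terms of its resolution σ_r. -/
theorem kernel_uniform_error_bound (n r : ℕ) (g : (Fin n → ℕ) → ℝ)
    (K : (Fin n → ℝ) → (Fin n → ℝ) → ℝ)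
    (hK : ∀ x y, K x y = ∑ α ∈ Nnr n r, g α * Tm α x * Tm α y)
    (hpos : ∀ x ∈ box n, ∀ y ∈ box n, 0 ≤ K x y)
    (hnormal : ∀ x ∈ box n, ∫ y, K x y ∂(chebMeasure n) = 1)
    (σ : ℝ)
    (hσ : σ = Real.sqrt (∫ x, ∫ y, eNorm (x - y) ^ 2 * K x y
      ∂(chebMeasure n) ∂(chebMeasure n)))
    (f : (Fin n → ℝ) → ℝ) (hf : ContinuousOn f (box n)) :
    ∀ x ∈ box n,
      |(∫ y, f y * K x y ∂(chebMeasure n)) - f x| ≤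
        2 * (1 + π / Real.sqrt 2) * modCont f (box n) σ := by
  have hKc : ∀ x, Continuous (K x) := by
    intro x
    have : K x = fun y => ∑ α ∈ Nnr n r, g α * Tm α x * Tm α y := funext (hK x)
    rw [this]; fun_prop
  choose l hl using fun i : Fin n => reproduce hK (Pi.single i 1)
  choose m hm using fun i : Fin n => reproduce hK (Pi.single i 2)
  simp only [Tm_one] at hl
  simp only [Tm_two] at hm
  have hK1 : ∀ x, Integrable (K x) (chebMeasure n) := fun x =>
    cheb_integrable (hKc x).continuousOn
  have hKi : ∀ x (h : (Fin n → ℝ) → ℝ), ContinuousOn h (box n) →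
      Integrable (fun y => h y * K x y) (chebMeasure n) := fun x h hh =>
    cheb_integrable (hh.mul (hKc x).continuousOn)
  have hsq : ∀ x ∈ box n, ∀ i, ∫ y, y i ^ 2 * K x y ∂chebMeasure n
      = (1 + m i * (2 * x i ^ 2 - 1)) / 2 := by
    intro x hx i
    have h := hm i x
    have e : (fun y : Fin n → ℝ => (2 * y i ^ 2 - 1) * K x y)
        = fun y => 2 * (y i ^ 2 * K x y) - K x y := by funext y; ring
    rw [e, integral_sub ((hKi x (fun y => y i ^ 2) (by fun_prop)).const_mul 2) (hK1 x),
      integral_const_mul, hnormal x hx] at h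
    linarith
  have hvar : ∀ x ∈ box n, ∫ y, eNorm (x - y) ^ 2 * K x y ∂chebMeasure n
      = ∑ i, (x i ^ 2 * (1 - 2 * l i + m i) + (1 - m i) / 2) := by
    intro x hx
    have e : (fun y : Fin n → ℝ => eNorm (x - y) ^ 2 * K x y)
        = fun y => ∑ i, (x i ^ 2 * K x y - 2 * x i * (y i * K x y) + y i ^ 2 * K x y) := by
      funext y
      rw [eNorm_sq, Finset.sum_mul]
      refine Finset.sum_congr rfl fun i _ => ?_
      simp only [Pi.sub_apply]; ring
    have i1 : ∀ i, Integrable (fun y => x i ^ 2 * K x y) (chebMeasure n) :=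
      fun i => (hK1 x).const_mul _
    have i2 : ∀ i, Integrable (fun y => 2 * x i * (y i * K x y)) (chebMeasure n) :=
      fun i => (hKi x (fun y => y i) (by fun_prop)).const_mul _
    have i3 : ∀ i, Integrable (fun y => y i ^ 2 * K x y) (chebMeasure n) :=
      fun i => hKi x (fun y => y i ^ 2) (by fun_prop)
    have i4 : ∀ i, Integrable (fun y => x i ^ 2 * K x y - 2 * x i * (y i * K x y))
        (chebMeasure n) := fun i => (i1 i).sub (i2 i)
    have i5 : ∀ i, Integrable (fun y => x i ^ 2 * K x y - 2 * x i * (y i * K x y)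
        + y i ^ 2 * K x y) (chebMeasure n) := fun i => (i4 i).add (i3 i)
    rw [e, integral_finsetSum _ (fun i _ => i5 i)]
    refine Finset.sum_congr rfl fun i _ => ?_
    rw [integral_add (i4 i) (i3 i), integral_sub (i1 i) (i2 i), integral_const_mul,
      integral_const_mul, hl, hsq x hx, hnormal x hx]
    ring
  have hdouble : ∫ x, ∫ y, eNorm (x - y) ^ 2 * K x y ∂(chebMeasure n) ∂(chebMeasure n)
      = ∑ i, (1 - l i) := by
    have : ∫ x, ∫ y, eNorm (x - y) ^ 2 * K x y ∂(chebMeasure n) ∂(chebMeasure n)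
        = ∫ x, ∑ i, (x i ^ 2 * (1 - 2 * l i + m i) + (1 - m i) / 2) ∂(chebMeasure n) := by
      refine integral_congr_ae ?_
      filter_upwards [ae_box n] with x hx using hvar x hx
    rw [this, integral_finsetSum _ (fun i _ => cheb_integrable (by fun_prop))]
    refine Finset.sum_congr rfl fun i _ => ?_
    rw [integral_add (cheb_integrable (by fun_prop)) (by simp), integral_mul_const, int_sq]
    simp
    ring
  -- eigenvalue estimates at the corner
  have hone : (fun _ => 1 : Fin n → ℝ) ∈ _root_.box n := fun i _ => by simp
  have hnonneg : ∀ (h : (Fin n → ℝ) → ℝ), ∀ x ∈ box n, (∀ y ∈ box n, 0 ≤ h y) →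
      0 ≤ ∫ y, h y * K x y ∂chebMeasure n := by
    intro h x hx hh
    refine integral_nonneg_of_ae ?_
    filter_upwards [ae_box n] with y hy using mul_nonneg (hh y hy) (hpos x hx y hy)
  have hcoord : ∀ y ∈ box n, ∀ i, -1 ≤ y i ∧ y i ≤ 1 := fun y hy i => hy i (Set.mem_univ i)
  have hml : ∀ i, (1 - m i) / 2 ≤ 2 * (1 - l i) := by
    intro i
    have h1 := hnonneg (fun y => (1 - y i) ^ 2) _ hone (fun y _ => sq_nonneg _)
    have e : (fun y : Fin n → ℝ => (1 - y i) ^ 2 * K (fun _ => 1) y)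
        = fun y => K (fun _ => 1) y - 2 * (y i * K (fun _ => 1) y)
          + y i ^ 2 * K (fun _ => 1) y := by funext y; ring
    have i2 := (hKi (fun _ => 1) (fun y => y i) (by fun_prop)).const_mul 2
    have i3 := hKi (fun _ => 1) (fun y => y i ^ 2) (by fun_prop)
    have i4 : Integrable (fun y => K (fun _ => 1) y - 2 * (y i * K (fun _ => 1) y))
        (chebMeasure n) := (hK1 _).sub i2
    rw [e, integral_add i4 i3, integral_sub (hK1 _) i2, integral_const_mul, hl,
      hsq _ hone, hnormal _ hone] at h1
    linarith
  have hm1 : ∀ i, m i ≤ 1 := by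
    intro i
    have h1 := hnonneg (fun y => 1 - y i ^ 2) _ hone (fun y hy => by
      have := hcoord y hy i; nlinarith)
    have e : (fun y : Fin n → ℝ => (1 - y i ^ 2) * K (fun _ => 1) y)
        = fun y => K (fun _ => 1) y - y i ^ 2 * K (fun _ => 1) y := by funext y; ring
    have i3 := hKi (fun _ => 1) (fun y => y i ^ 2) (by fun_prop)
    rw [e, integral_sub (hK1 _) i3, hsq _ hone, hnormal _ hone] at h1
    linarith
  have hl1 : ∀ i, 0 ≤ 1 - l i := fun i => by linarith [hml i, hm1 i]
  have hσ2 : σ ^ 2 = ∑ i, (1 - l i) := by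
    rw [hσ, hdouble, Real.sq_sqrt (Finset.sum_nonneg fun i _ => hl1 i)]
  have hσ0 : 0 ≤ σ := by rw [hσ]; exact Real.sqrt_nonneg _
  have hvarle : ∀ x ∈ box n, ∫ y, eNorm (x - y) ^ 2 * K x y ∂chebMeasure n ≤ 2 * σ ^ 2 := by
    intro x hx
    rw [hvar x hx, hσ2, Finset.mul_sum]
    refine Finset.sum_le_sum fun i _ => ?_
    have h1 := hcoord x hx i
    have h2 : x i ^ 2 ≤ 1 := by nlinarith
    have h3 := hml i
    have h4 := hm1 i
    nlinarith [mul_nonneg (sub_nonneg.2 h2) (sub_nonneg.2 h3), mul_nonneg (sq_nonneg (x i)) (sub_nonneg.2 h4)]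
  intro x hx
  have hnormc : Continuous fun y : Fin n → ℝ => eNorm (x - y) ^ 2 := by
    simp only [eNorm_sq, Pi.sub_apply]; fun_prop
  have hdiff : (∫ y, f y * K x y ∂(chebMeasure n)) - f x
      = ∫ y, (f y - f x) * K x y ∂(chebMeasure n) := by
    simp only [sub_mul]
    rw [integral_sub (hKi x f hf) ((hK1 x).const_mul _), integral_const_mul, hnormal x hx, mul_one]
  have hM := modCont_nonneg f (box n) σ
  have hc : 3 ≤ 2 * (1 + π / Real.sqrt 2) := by
    have h2 : Real.sqrt 2 ≤ 2 := by
      rw [Real.sqrt_le_left (by norm_num)]; norm_num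
    have h3 : 1 ≤ π / Real.sqrt 2 := by
      rw [le_div_iff₀ (by positivity)]; linarith [Real.pi_gt_three]
    linarith
  rw [hdiff]
  rcases hσ0.eq_or_lt with h0 | hpos'
  · have hz : ∫ y, eNorm (x - y) ^ 2 * K x y ∂chebMeasure n = 0 := by
      refine le_antisymm ?_ (hnonneg _ x hx fun y _ => sq_nonneg _)
      have := hvarle x hx
      rw [← h0] at this; simpa using this
    rw [integral_eq_zero_iff_of_nonneg_ae ?_ (hKi x _ hnormc.continuousOn)] at hz
    · have : ∫ y, (f y - f x) * K x y ∂(chebMeasure n) = 0 := by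
        refine integral_eq_zero_of_ae ?_
        filter_upwards [hz] with y hy
        simp only [Pi.zero_apply, mul_eq_zero] at hy ⊢
        rcases hy with hy | hy
        · left
          rw [eNorm_sq, Finset.sum_eq_zero_iff_of_nonneg (fun _ _ => sq_nonneg _)] at hy
          have : x = y := by
            funext i
            have := hy i (Finset.mem_univ i)
            simp only [Pi.sub_apply] at this
            exact sub_eq_zero.1 (pow_eq_zero_iff two_ne_zero |>.1 this)
          rw [this, sub_self]
        · right; exact hy
      rw [this, abs_zero]
      positivity
    · filter_upwards [ae_box n] with y hy using mul_nonneg (sq_nonneg _) (hpos x hx y hy)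
  · set M := modCont f (box n) σ with hMdef
    have i4 := hKi x _ hnormc.continuousOn
    calc |∫ y, (f y - f x) * K x y ∂(chebMeasure n)|
        ≤ ∫ y, |(f y - f x) * K x y| ∂(chebMeasure n) := abs_integral_le_integral_abs
      _ ≤ ∫ y, (M * K x y + M / σ ^ 2 * (eNorm (x - y) ^ 2 * K x y)) ∂(chebMeasure n) := by
        refine integral_mono_ae (hKi x (fun y => f y - f x) (by fun_prop)).abs
          (((hK1 x).const_mul _).add (i4.const_mul _)) ?_
        filter_upwards [ae_box n] with y hy
        have h1 := quad_bound hf hpos' hx hy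
        have h2 := hpos x hx y hy
        rw [abs_mul, abs_of_nonneg h2, abs_sub_comm]
        refine (mul_le_mul_of_nonneg_right h1 h2).trans (le_of_eq ?_)
        rw [← hMdef]; ring
      _ = M + M / σ ^ 2 * ∫ y, eNorm (x - y) ^ 2 * K x y ∂chebMeasure n := by
        rw [integral_add ((hK1 x).const_mul _) (i4.const_mul _), integral_const_mul,
          integral_const_mul, hnormal x hx, mul_one]
      _ ≤ M + M / σ ^ 2 * (2 * σ ^ 2) := by gcongr; exact hvarle x hx
      _ = 3 * M := by field_simp; ring
      _ ≤ 2 * (1 + π / Real.sqrt 2) * M := by gcongr
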